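/- arXiv:1309.5301 — 2 statements merged into one kernel-verified Lean document; each statement's English description precedes it below -/
import Mathlib

section
/- Let C ≥ 1, let a₀, a₁, ..., a_C be C + 1 pairwise distinct memory blocks, and let σₙ be the concatenation of n copies of the access sequence (a₀, a₁, ..., a_C). Then for every initial cache state s of an LRU cache of capacity C, misses(σₙ, s) ≥ (n − 1)·(C + 1). (The cyclic-thrashing lower bound holds regardless of the cache contents at the moment the bad access pattern begins, as required in the executions analyzed in Theorems 4 and 5.) -/
variable {α : Type*} [DecidableEq α]

/-- One LRU access of block `b` on a cache state `s` (capacity `C`):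
on a hit, `b` moves to the front; on a miss, `b` is placed at the front and,
if the resulting list has length `C + 1`, the last element is evicted. -/
def lruAccess (C : ℕ) (b : α) (s : List α) : List α :=
  if b ∈ s then b :: s.erase b else (b :: s).take C

/-- The cache state after processing the access sequence `σ` from state `s`. -/
def lruRun (C : ℕ) : List α → List α → List α
  | [], s => s
  | b :: σ, s => lruRun C σ (lruAccess C b s)

/-- The number of LRU misses incurred while processing the access sequence `σ`
starting from cache state `s`. -/
def lruMisses (C : ℕ) : List α → List α → ℕ
  | [], _ => 0
  | b :: σ, s => (if b ∈ s then 0 else 1) + lruMisses C σ (lruAccess C b s)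

/-- The concatenation of `n` copies of the list `l`. -/
def listReps (l : List α) : ℕ → List α
  | 0 => []
  | n + 1 => l ++ listReps l n

theorem lruMisses_append (C : ℕ) (σ τ s : List α) :
    lruMisses C (σ ++ τ) s = lruMisses C σ s + lruMisses C τ (lruRun C σ s) := by
  induction σ generalizing s with
  | nil => simp [lruMisses, lruRun]
  | cons b σ ih => simp [lruMisses, lruRun, ih, add_assoc]

theorem length_lruAccess_le {C : ℕ} {s : List α} (hs : s.length ≤ C) (b : α) :
    (lruAccess C b s).length ≤ C := by
  unfold lruAccess
  split_ifs with hb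
  · have := List.length_pos_of_mem hb
    rw [List.length_cons, List.length_erase_of_mem hb]
    omega
  · simp

theorem length_lruRun_le {C : ℕ} (σ : List α) {s : List α} (hs : s.length ≤ C) :
    (lruRun C σ s).length ≤ C := by
  induction σ generalizing s with
  | nil => exact hs
  | cons b σ ih => exact ih (length_lruAccess_le hs b)

/-- If the cache starts with the last `C` blocks of a (reversed) history `p`, it still does so
after accessing a block that does not occur in `p`. -/
theorem take_cons_prefix_lruAccess {C : ℕ} {p s : List α} {b : α} (hp : p.take C <+: s)
    (hb : b ∉ p) : (b :: p).take C <+: lruAccess C b s := by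
  cases C with
  | zero => simp
  | succ C =>
    have hle : p.take C <+: p.take (C + 1) := List.take_prefix_take_left (Nat.le_succ C)
    unfold lruAccess
    split_ifs with hbs
    · obtain ⟨t, rfl⟩ := hp
      rw [List.erase_append_right _ fun h => hb (List.mem_of_mem_take h), List.take_succ_cons,
        List.cons_prefix_cons]
      exact ⟨rfl, hle.trans (List.prefix_append _ _)⟩
    · rw [List.take_succ_cons, List.take_succ_cons, List.cons_prefix_cons]
      refine ⟨rfl, ?_⟩
      simpa [List.take_take] using hp.take C

theorem take_reverse_append_prefix_lruRun {C : ℕ} (σ : List α) {p s : List α}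
    (hp : p.take C <+: s) (hnd : (σ.reverse ++ p).Nodup) :
    (σ.reverse ++ p).take C <+: lruRun C σ s := by
  induction σ generalizing p s with
  | nil => simpa [lruRun] using hp
  | cons b σ ih =>
    simp only [List.reverse_cons, List.append_assoc, List.singleton_append] at hnd ⊢
    exact ih (take_cons_prefix_lruAccess hp (List.nodup_cons.mp hnd.of_append_right).1) hnd

theorem lruRun_eq_take_reverse {C : ℕ} {l s : List α} (hl : l.Nodup) (hC : C ≤ l.length)
    (hs : s.length ≤ C) : lruRun C l s = l.reverse.take C := by
  have h : l.reverse.take C <+: lruRun C l s := by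
    simpa using take_reverse_append_prefix_lruRun (C := C) (p := []) (s := s) l (by simp)
      (by simpa using hl)
  refine (h.eq_of_length_le ?_).symm
  simpa [hC] using length_lruRun_le l hs

/-- While cycling through `C + 1` distinct blocks, the block accessed next is always
the only one that is not cached. -/
theorem lruMisses_append_rotate {C : ℕ} (x y τ : List α) (hnd : (y ++ x).Nodup)
    (hlen : (y ++ x).length = C + 1) :
    lruMisses C (y ++ τ) ((y ++ x).reverse.take C) =
      y.length + lruMisses C τ ((x ++ y).reverse.take C) := by
  induction y generalizing x with
  | nil => simp
  | cons b y ih =>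
    have hlen' : (y ++ x).reverse.length = C := by simpa [add_comm] using hlen
    have hb : b ∉ (y ++ x).reverse := by
      rw [List.mem_reverse]; exact (List.nodup_cons.mp hnd).1
    have hstate : (b :: y ++ x).reverse.take C = (y ++ x).reverse := by
      rw [List.cons_append, List.reverse_cons, ← hlen', List.take_left]
    have hacc : lruAccess C b (y ++ x).reverse = (y ++ (x ++ [b])).reverse.take C := by
      rw [lruAccess, if_neg hb, ← List.append_assoc, List.reverse_append (bs := [b])]
      rfl
    have hperm : (b :: y ++ x).Perm (y ++ (x ++ [b])) := by
      rw [← List.append_assoc]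
      exact (List.perm_append_singleton b (y ++ x)).symm
    rw [hstate, List.cons_append, lruMisses, if_neg hb, hacc,
      ih (x ++ [b]) (hperm.nodup_iff.mp hnd) (hperm.length_eq ▸ hlen)]
    simp only [List.length_cons, List.append_assoc, List.singleton_append]
    omega

theorem lruMisses_listReps {C : ℕ} {l : List α} (hl : l.Nodup) (hlen : l.length = C + 1) (n : ℕ) :
    lruMisses C (listReps l n) (l.reverse.take C) = n * (C + 1) := by
  induction n with
  | zero => simp [listReps, lruMisses]
  | succ n ih =>
    have h := lruMisses_append_rotate (C := C) [] l (listReps l n) (by simpa using hl)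
      (by simpa using hlen)
    rw [List.append_nil, List.nil_append, ih, hlen] at h
    rw [listReps, h]
    ring

/-- LRU thrashing from an arbitrary initial state: for any valid cache state
`s` (pairwise distinct blocks, length at most `C`), `n` repetitions of the
cyclic pattern `a₀, a₁, …, a_C` over `C + 1` pairwise distinct blocks incur at
least `(n − 1)·(C + 1)` misses. -/
theorem lru_cyclic_thrashing_from_any_state {α : Type*} [DecidableEq α]
    (C : ℕ) (hC : 1 ≤ C) (a : Fin (C + 1) → α) (ha : Function.Injective a)
    (n : ℕ) (s : List α) (hnodup : s.Nodup) (hlen : s.length ≤ C) :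
    (n - 1) * (C + 1) ≤ lruMisses C (listReps (List.ofFn a) n) s := by
  cases n with
  | zero => simp
  | succ n =>
    have hl : (List.ofFn a).Nodup := List.nodup_ofFn.mpr ha
    have hlen' : (List.ofFn a).length = C + 1 := List.length_ofFn
    rw [listReps, lruMisses_append, lruRun_eq_take_reverse hl (by omega) hlen,
      lruMisses_listReps hl hlen', Nat.add_sub_cancel]
    exact Nat.le_add_left _ _
end

section
/- Let C ≥ 1 and let a, b₁, ..., b_C be C + 1 pairwise distinct memory blocks. Let σₙ (n ≥ 1) be the concatenation of n copies of the access sequence (a, a, b₁, b₂, ..., b_{C−1}, b_C, b_C, b_{C−1}, ..., b₂, b₁), i.e., each repetition accesses a twice, then b₁ through b_C in increasing order, then b_C through b₁ in decreasing order. Then an LRU cache of capacity C starting from the empty state satisfies misses(σₙ, ∅) = (C + 1) + 2·(n − 1): after the first repetition, each repetition incurs exactly two misses (at the first access to a and at the increasing-order access to b_C). (This is the access pattern of the sequential execution of the lower-bound DAG in Theorem 4 — nodes uᵢ, xᵢ, Yᵢ, Zᵢ — which incurs only O(k + C) cache misses over k repetitions.) -/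
variable {α : Type*} [DecidableEq α]

/-- Accessing in order a block of consecutive cached elements only hits, and moves the reversed
block to the front. -/
theorem lruMisses_append_of_cached (C : ℕ) (l r t τ : List α) (h : (r ++ (l ++ t)).Nodup) :
    lruMisses C (l ++ τ) (r ++ (l ++ t)) = lruMisses C τ (l.reverse ++ (r ++ t)) := by
  induction l generalizing r with
  | nil => simp
  | cons x l ih =>
    have hx : x ∉ r := by
      intro hx
      exact (List.nodup_append.mp h).2.2 x hx x (by simp) rfl
    have hperm : (r ++ (x :: l ++ t)).Perm ((x :: r) ++ (l ++ t)) := by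
      simp
    have hacc : lruAccess C x (r ++ (x :: l ++ t)) = (x :: r) ++ (l ++ t) := by
      simp [lruAccess, List.erase_append_right _ hx]
    rw [List.cons_append, lruMisses, hacc, ih (x :: r) (hperm.nodup h)]
    simp

/-- Accessing distinct uncached elements that fit in the cache always misses and evicts nothing. -/
theorem lruMisses_append_of_fits (C : ℕ) (l s τ : List α) (h : (l ++ s).Nodup)
    (hlen : l.length + s.length ≤ C) :
    lruMisses C (l ++ τ) s = l.length + lruMisses C τ (l.reverse ++ s) := by
  induction l generalizing s with
  | nil => simp
  | cons x l ih =>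
    have hx : x ∉ s := fun hx => (List.nodup_cons.mp h).1 (by simp [hx])
    have hperm : (x :: l ++ s).Perm (l ++ x :: s) := List.perm_middle.symm
    simp only [List.length_cons] at hlen
    have hacc : lruAccess C x s = x :: s := by
      rw [lruAccess, if_neg hx, List.take_of_length_le (by simp; omega)]
    rw [List.cons_append, lruMisses, if_neg hx, hacc,
      ih (x :: s) (hperm.nodup h) (by simp; omega)]
    simp
    omega

/-- Immediately repeating an access is a hit and leaves the cache unchanged. -/
theorem lruMisses_cons_head (C : ℕ) (x : α) (s τ : List α) :
    lruMisses C (x :: τ) (x :: s) = lruMisses C τ (x :: s) := by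
  simp [lruMisses, lruAccess]

/-- The access of an uncached `x` to a full cache evicts the last element; descending through
the cache then only hits and reverses it. -/
theorem lruMisses_turn (a x : α) (l τ : List α) (h : (a :: (l ++ [x])).Nodup) :
    lruMisses (l.length + 1) (x :: ((l ++ [x]).reverse ++ τ)) (l.reverse ++ [a])
      = 1 + lruMisses (l.length + 1) τ (l ++ [x]) := by
  have hx : x ∉ l.reverse ++ [a] := by
    simp [List.nodup_append] at h ⊢
    grind
  have hacc : lruAccess (l.length + 1) x (l.reverse ++ [a]) = (l ++ [x]).reverse := by
    simp [lruAccess, hx]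
  have hnd : (l ++ [x]).reverse.Nodup := List.nodup_reverse.mpr (List.nodup_cons.mp h).2
  have := lruMisses_append_of_cached (l.length + 1) (l ++ [x]).reverse [] [] τ (by simpa using hnd)
  rw [lruMisses, if_neg hx, hacc]
  simpa using this

/-- One repetition of the pattern from the empty cache. -/
theorem lruMisses_pattern_nil (a x : α) (l τ : List α) (h : (a :: (l ++ [x])).Nodup) :
    lruMisses (l.length + 1) (a :: a :: ((l ++ [x]) ++ (l ++ [x]).reverse) ++ τ) []
      = l.length + 2 + lruMisses (l.length + 1) τ (l ++ [x]) := by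
  have hnd : (l ++ [a]).Nodup := by
    simp [List.nodup_append] at h ⊢
    grind
  have hfill := lruMisses_append_of_fits (l.length + 1) l [a]
    (x :: ((l ++ [x]).reverse ++ τ)) hnd (by simp)
  rw [lruMisses_turn a x l τ h] at hfill
  have hacc : lruAccess (l.length + 1) a [] = [a] := by simp [lruAccess]
  simp only [List.cons_append, List.append_assoc, List.nil_append]
  rw [lruMisses, hacc, lruMisses_cons_head, hfill]
  simp
  omega

/-- One repetition of the pattern from the state left by the previous repetition. -/
theorem lruMisses_pattern_full (a x : α) (l τ : List α) (h : (a :: (l ++ [x])).Nodup) :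
    lruMisses (l.length + 1) (a :: a :: ((l ++ [x]) ++ (l ++ [x]).reverse) ++ τ) (l ++ [x])
      = 2 + lruMisses (l.length + 1) τ (l ++ [x]) := by
  have ha : a ∉ l ++ [x] := (List.nodup_cons.mp h).1
  have hnd : (a :: l).Nodup := by
    simp [List.nodup_append] at h ⊢
    grind
  have hhit := lruMisses_append_of_cached (l.length + 1) l [a] []
    (x :: ((l ++ [x]).reverse ++ τ)) (by simpa using hnd)
  simp only [List.append_nil, List.cons_append, List.nil_append] at hhit
  rw [lruMisses_turn a x l τ h] at hhit
  have hacc : lruAccess (l.length + 1) a (l ++ [x]) = a :: l := by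
    simp [lruAccess, ha]
  simp only [List.cons_append, List.append_assoc, List.nil_append]
  rw [lruMisses, if_neg ha, hacc, lruMisses_cons_head, hhit]
  omega

/-- Every repetition of the pattern after the first costs two misses. -/
theorem lruMisses_listReps_full (a x : α) (l : List α) (h : (a :: (l ++ [x])).Nodup) (n : ℕ) :
    lruMisses (l.length + 1) (listReps (a :: a :: ((l ++ [x]) ++ (l ++ [x]).reverse)) n) (l ++ [x])
      = 2 * n := by
  induction n with
  | zero => rfl
  | succ n ih =>
    rw [listReps, lruMisses_pattern_full a x l _ h, ih]
    ring

/-- The access pattern of the sequential execution of the lower-bound DAG of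
Theorem 4: `n ≥ 1` repetitions of
`(a, a, b₁, …, b_{C-1}, b_C, b_C, b_{C-1}, …, b₁)` — `a` twice, then
`b₁ … b_C` in increasing order, then `b_C … b₁` in decreasing order — over
`C + 1` pairwise distinct blocks incur exactly `(C + 1) + 2·(n − 1)` misses on
an initially empty LRU cache of capacity `C ≥ 1`: after the first repetition,
each repetition misses only at the first access to `a` and at the
increasing-order access to `b_C`. -/
theorem lru_sequential_pattern_misses {α : Type*} [DecidableEq α]
    (C : ℕ) (hC : 1 ≤ C) (a : α) (b : Fin C → α)
    (hb : Function.Injective b) (hab : ∀ i, a ≠ b i)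
    (n : ℕ) (hn : 1 ≤ n) :
    lruMisses C
        (listReps (a :: a :: (List.ofFn b ++ (List.ofFn b).reverse)) n)
        ([] : List α)
      = (C + 1) + 2 * (n - 1) := by
  obtain ⟨m, rfl⟩ : ∃ m, n = m + 1 := ⟨n - 1, by omega⟩
  have hnd : (a :: List.ofFn b).Nodup := by
    rw [List.nodup_cons, List.nodup_ofFn]
    exact ⟨by simpa [List.mem_ofFn, eq_comm] using hab, hb⟩
  have hlen : (List.ofFn b).length = C := List.length_ofFn
  generalize List.ofFn b = L at hnd hlen ⊢
  obtain rfl | ⟨l, x, rfl⟩ := L.eq_nil_or_concat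
  · simp at hlen
    omega
  · simp only [List.concat_eq_append] at hnd hlen ⊢
    obtain rfl : C = l.length + 1 := by simpa using hlen.symm
    rw [listReps, lruMisses_pattern_nil a x l _ hnd, lruMisses_listReps_full a x l hnd]
    omega
end
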